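/- For integers r ≥ 2 and q ≥ 1, let α_{r,n,q} denote the number of monomials x_1^{c_1}···x_r^{c_r} of total degree n with 0 ≤ c_i ≤ q-1 for all i, and let α_{s,n} = C(n+s-1, s-1). Then lim_{q→∞} (1/q^d) Σ_{n=0}^{r(q-1)} α_{r,n,q}·α_{s,n} = (r!/d!)·S(d,r), where d = r+s-1 and S(d,r) is the Stirling number of the second kind. -/

import Mathlib

open Finset Filter

/-- The Stirling number of the second kind `S(n,k)`: the number of partitions of
`{1,...,n}` into `k` (nonempty, pairwise disjoint, covering) blocks. -/
noncomputable def stirling (n k : ℕ) : ℕ := by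
  classical
  exact ((Finset.univ : Finset (Finset (Finset (Fin n)))).filter
    (fun P => P.card = k ∧ (∀ B ∈ P, B.Nonempty) ∧ (∀ x : Fin n, ∃ B ∈ P, x ∈ B) ∧
      (∀ B ∈ P, ∀ C ∈ P, B ≠ C → Disjoint B C))).card

/-- `α_{r,n,q}`: the number of monomials `x_1^{c_1}⋯x_r^{c_r}` of total degree `n`
with `0 ≤ c_i ≤ q-1` for all `i`. -/
noncomputable def alphaCount (r n q : ℕ) : ℕ := by
  classical
  exact ((Finset.univ : Finset (Fin r → Fin q)).filter
    (fun c => ∑ i, (c i : ℕ) = n)).card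

open fwdDiff

lemma hockey (x k s q : ℕ) : ∑ c ∈ range q, ((Nat.choose (x + c + s) k : ℕ) : ℝ) = (Nat.choose (x + q + s) (k+1) : ℝ) - (Nat.choose (x + s) (k+1) : ℝ) := by
  induction q with
  | zero => simp
  | succ q ih =>
    rw [sum_range_succ, ih, show x + (q+1) + s = (x + q + s) + 1 by ring, Nat.choose_succ_succ]
    push_cast; ring

lemma iter_sum (q s : ℕ) (r : ℕ) : ∀ k x : ℕ, ∑ c : Fin r → Fin q, ((Nat.choose (x + ∑ i, (c i : ℕ) + s) k : ℕ) : ℝ)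
    = (fwdDiff q)^[r] (fun x : ℕ => ((Nat.choose (x + s) (k + r) : ℕ) : ℝ)) x := by
  induction r with
  | zero => intro k x; simp
  | succ r ih =>
    intro k x
    rw [← (Fin.consEquiv (fun _ : Fin (r+1) => Fin q)).sum_comp, Fintype.sum_prod_type_right,
      Function.iterate_succ_apply', fwdDiff]
    have h : ∀ k, k + (r+1) = (k + 1) + r := fun k => by ring
    simp only [h, ← ih, ← sum_sub_distrib]
    refine sum_congr rfl fun c _ => ?_
    simp only [Fin.consEquiv, Equiv.coe_fn_mk, Fin.sum_univ_succ, Fin.cons_zero, Fin.cons_succ]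
    rw [Fin.sum_univ_eq_sum_range (fun a => ((Nat.choose (x + (a + ∑ i, (c i : ℕ)) + s) k : ℕ) : ℝ))]
    have := hockey (x + ∑ i, (c i : ℕ)) k s q
    convert this using 4 <;> ring_nf

lemma lim_choose (j s d : ℕ) : Tendsto (fun q : ℕ => (Nat.choose (j * q + s) d : ℝ) / (q:ℝ)^d) atTop (nhds ((j:ℝ)^d / d.factorial)) := by
  have h1 : ∀ i : ℕ, Tendsto (fun q : ℕ => ((j:ℝ) * q + s - i) / q) atTop (nhds (j:ℝ)) := by
    intro i
    have h := (tendsto_const_div_atTop_nhds_zero_nat ((s:ℝ) - i)).const_add (j:ℝ)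
    rw [add_zero] at h
    refine h.congr' ?_
    filter_upwards [eventually_gt_atTop 0] with q hq
    have : (q:ℝ) ≠ 0 := by positivity
    field_simp
    ring
  have h2 := (tendsto_finsetProd (range d) (fun i _ => h1 i)).div_const (d.factorial : ℝ)
  rw [prod_const, card_range] at h2
  refine h2.congr fun q => ?_
  have h3 : (Nat.choose (j * q + s) d : ℝ) * d.factorial = ∏ i ∈ range d, ((j:ℝ) * q + s - i) := by
    have := descPochhammer_eval_eq_descFactorial ℝ (j * q + s) d
    rw [descPochhammer_eval_eq_prod_range, Nat.descFactorial_eq_factorial_mul_choose] at this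
    push_cast at this
    rw [this]; ring
  rw [prod_div_distrib, ← h3, prod_const, card_range]
  have : (d.factorial : ℝ) ≠ 0 := by positivity
  field_simp

lemma surj_count (d r : ℕ) : ((univ.filter (fun f : Fin d → Fin r => Function.Surjective f)).card : ℤ)
   = ∑ j ∈ range (r+1), (-1:ℤ)^(r-j) * r.choose j * (j:ℤ)^d := by
  have h := Finset.inclusion_exclusion_card_inf_compl (univ : Finset (Fin r)) (fun i => univ.filter (fun f : Fin d → Fin r => ∀ x, f x ≠ i))
  have e : (univ : Finset (Fin r)).inf (fun i => (univ.filter (fun f : Fin d → Fin r => ∀ x, f x ≠ i))ᶜ) = univ.filter (fun f : Fin d → Fin r => Function.Surjective f) := by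
    ext f
    simp only [Finset.mem_inf, mem_compl, mem_filter, mem_univ, true_and]
    simp [Function.Surjective]
  rw [e] at h
  rw [h]
  have e2 : ∀ t : Finset (Fin r), ((t.inf (fun i => univ.filter (fun f : Fin d → Fin r => ∀ x, f x ≠ i))).card) = (r - t.card)^d := by
    intro t
    have : t.inf (fun i => univ.filter (fun f : Fin d → Fin r => ∀ x, f x ≠ i)) = Fintype.piFinset (fun _ : Fin d => tᶜ) := by
      ext f
      simp only [Finset.mem_inf, mem_filter, mem_univ, true_and, Fintype.mem_piFinset, mem_compl]
      exact ⟨fun h x hx => h _ hx x rfl, fun h i hi x hx => h x (hx ▸ hi)⟩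
    rw [this, Fintype.card_piFinset]
    simp [card_compl]
  simp only [e2]
  rw [Finset.sum_powerset_apply_card (fun m => (-1:ℤ)^m * (((r-m)^d : ℕ):ℤ)), ← Finset.sum_range_reflect]
  simp only [card_univ, Fintype.card_fin]
  refine sum_congr rfl fun j hj => ?_
  have hj : j ≤ r := by simpa [Nat.lt_succ_iff] using hj
  rw [show r + 1 - 1 - j = r - j by omega, Nat.choose_symm hj, Nat.sub_sub_self hj]
  simp; ring

/-- The set partitions of `Fin n` into `k` blocks, as in the definition of `stirling`. -/
def IsPart (n k : ℕ) (P : Finset (Finset (Fin n))) : Prop :=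
  P.card = k ∧ (∀ B ∈ P, B.Nonempty) ∧ (∀ x : Fin n, ∃ B ∈ P, x ∈ B) ∧
      (∀ B ∈ P, ∀ C ∈ P, B ≠ C → Disjoint B C)

/-- The fibres of a map. -/
def fib {d r : ℕ} (f : Fin d → Fin r) (i : Fin r) : Finset (Fin d) := univ.filter (fun x => f x = i)

lemma mem_fib {d r : ℕ} (f : Fin d → Fin r) (i : Fin r) (x : Fin d) : x ∈ fib f i ↔ f x = i := by
  simp [fib]

open Classical in
lemma card_inj_image (d r : ℕ) (P : Finset (Finset (Fin d))) (hP : P.card = r) :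
    (univ.filter (fun g : Fin r → Finset (Fin d) => Function.Injective g ∧ univ.image g = P)).card
      = r.factorial := by
  have h : Fintype.card (Fin r ↪ P) = r.factorial := by
    rw [Fintype.card_embedding_eq]
    simp [hP, Nat.descFactorial_self]
  rw [← h, ← Finset.card_univ]
  symm
  refine Finset.card_bij (fun e _ i => (e i : Finset (Fin d))) ?_ ?_ ?_
  · intro e _
    have hi : Function.Injective (fun i => (e i : Finset (Fin d))) :=
      Subtype.val_injective.comp e.injective
    simp only [mem_filter, mem_univ, true_and]
    refine ⟨hi, ?_⟩
    apply Finset.eq_of_subset_of_card_le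
    · intro B hB
      obtain ⟨i, _, rfl⟩ := Finset.mem_image.1 hB
      exact (e i).2
    · rw [Finset.card_image_of_injective _ hi, hP]; simp
  · intro e _ e' _ h
    ext1 i
    exact Subtype.ext (congrFun h i)
  · intro g hg
    simp only [mem_filter, mem_univ, true_and] at hg
    obtain ⟨hg, rfl⟩ := hg
    exact ⟨⟨fun i => ⟨g i, Finset.mem_image_of_mem _ (mem_univ _)⟩,
      fun i j h => hg (congrArg Subtype.val h)⟩, mem_univ _, rfl⟩

open Classical in
lemma surj_stirling (d r : ℕ) :
    (univ.filter (fun f : Fin d → Fin r => Function.Surjective f)).card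
      = r.factorial * stirling d r := by
  have h1 : (univ.filter (fun f : Fin d → Fin r => Function.Surjective f)).card
      = (univ.filter (fun g : Fin r → Finset (Fin d) =>
          Function.Injective g ∧ IsPart d r (univ.image g))).card := by
    refine Finset.card_bij (fun f _ => fib f) ?_ ?_ ?_
    · intro f hf
      simp only [mem_filter, mem_univ, true_and] at hf ⊢
      have hi : Function.Injective (fib f) := by
        intro i j hij
        obtain ⟨x, hx⟩ := hf i
        have : x ∈ fib f j := hij ▸ (mem_fib f i x).2 hx
        rw [← hx, (mem_fib f j x).1 this]
      refine ⟨hi, ?_, ?_, ?_, ?_⟩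
      · rw [Finset.card_image_of_injective _ hi]; simp
      · intro B hB
        obtain ⟨i, _, rfl⟩ := Finset.mem_image.1 hB
        obtain ⟨x, hx⟩ := hf i
        exact ⟨x, (mem_fib f i x).2 hx⟩
      · intro x
        exact ⟨fib f (f x), Finset.mem_image_of_mem _ (mem_univ _), (mem_fib _ _ _).2 rfl⟩
      · intro B hB C hC hBC
        obtain ⟨i, _, rfl⟩ := Finset.mem_image.1 hB
        obtain ⟨j, _, rfl⟩ := Finset.mem_image.1 hC
        rw [Finset.disjoint_left]
        intro x hx hx'
        rw [mem_fib] at hx hx'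
        exact hBC (by rw [← hx, ← hx'])
    · intro f _ f' _ h
      funext x
      have : x ∈ fib f' (f x) := congrFun h (f x) ▸ (mem_fib f (f x) x).2 rfl
      exact ((mem_fib _ _ _).1 this).symm
    · intro g hg
      simp only [mem_filter, mem_univ, true_and] at hg
      obtain ⟨hi, _, hne, hcov, hdis⟩ := hg
      have hc : ∀ x, ∃ i, x ∈ g i := by
        intro x
        obtain ⟨B, hB, hx⟩ := hcov x
        obtain ⟨i, _, rfl⟩ := Finset.mem_image.1 hB
        exact ⟨i, hx⟩
      choose f hf using hc
      have huniq : ∀ x i, x ∈ g i → f x = i := by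
        intro x i hx
        by_contra hne'
        exact Finset.disjoint_left.1 (hdis (g (f x)) (Finset.mem_image_of_mem _ (mem_univ _)) (g i)
          (Finset.mem_image_of_mem _ (mem_univ _)) (fun h => hne' (hi h))) (hf x) hx
      refine ⟨f, ?_, ?_⟩
      · simp only [mem_filter, mem_univ, true_and]
        intro i
        obtain ⟨x, hx⟩ := hne (g i) (Finset.mem_image_of_mem _ (mem_univ _))
        exact ⟨x, huniq x i hx⟩
      · funext i
        ext x
        rw [mem_fib]
        exact ⟨fun h => h ▸ hf x, huniq x i⟩
  have h2 : stirling d r = (univ.filter (fun P => IsPart d r P)).card := by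
    unfold stirling IsPart
    congr
  rw [h1, h2, Finset.card_eq_sum_card_fiberwise (f := fun g => univ.image g)
    (t := univ.filter (fun P => IsPart d r P))]
  · rw [mul_comm, ← smul_eq_mul, ← Finset.sum_const]
    refine sum_congr rfl fun P hP => ?_
    have hP := (mem_filter.1 hP).2
    rw [← card_inj_image d r P hP.1, Finset.filter_filter]
    congr 1
    ext g
    simp only [mem_filter, mem_univ, true_and]
    constructor
    · rintro ⟨⟨a, _⟩, b⟩
      exact ⟨a, b⟩
    · rintro ⟨a, b⟩
      exact ⟨⟨a, b ▸ hP⟩, b⟩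
  · intro g hg
    have := (mem_filter.1 (Finset.mem_coe.1 hg)).2.2
    exact Finset.mem_coe.2 (mem_filter.2 ⟨mem_univ _, this⟩)

lemma stirling_formula (d r : ℕ) : (r.factorial : ℝ) * (stirling d r : ℝ)
    = ∑ j ∈ range (r+1), (-1:ℝ)^(r-j) * r.choose j * (j:ℝ)^d := by
  have h := surj_count d r
  have h2 := surj_stirling d r
  have h3 : ((r.factorial * stirling d r : ℕ) : ℤ)
      = ∑ j ∈ range (r+1), (-1:ℤ)^(r-j) * r.choose j * (j:ℤ)^d := by
    rw [← h, ← h2]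
  exact_mod_cast congrArg (Int.cast : ℤ → ℝ) h3

lemma alpha_sum (r s q : ℕ) : ∑ n ∈ Finset.range (r * (q - 1) + 1),
      (alphaCount r n q : ℝ) * (Nat.choose (n + s) s : ℝ)
    = ∑ c : Fin r → Fin q, ((Nat.choose (0 + ∑ i, (c i : ℕ) + s) s : ℕ) : ℝ) := by
  classical
  rw [← Finset.sum_fiberwise_of_maps_to (s := univ) (t := Finset.range (r * (q - 1) + 1))
    (g := fun c : Fin r → Fin q => ∑ i, (c i : ℕ))]
  · refine sum_congr rfl fun n _ => ?_
    have : ∀ c ∈ univ.filter (fun c : Fin r → Fin q => ∑ i, (c i : ℕ) = n),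
        ((Nat.choose (0 + ∑ i, (c i : ℕ) + s) s : ℕ) : ℝ) = (Nat.choose (n + s) s : ℝ) := by
      intro c hc
      rw [(mem_filter.1 hc).2, zero_add]
    rw [sum_congr rfl this, sum_const, nsmul_eq_mul]
    congr 2
  · intro c _
    rw [mem_range, Nat.lt_succ_iff]
    calc ∑ i, (c i : ℕ) ≤ ∑ _i : Fin r, (q - 1) :=
          sum_le_sum fun i _ => by have := (c i).2; omega
      _ = r * (q - 1) := by simp

/-- `lim_{q→∞} (1/q^d) Σ_{n=0}^{r(q-1)} α_{r,n,q} · C(n+s-1,s-1) = (r!/d!)·S(d,r)`,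
where `d = r+s-1`. -/
theorem alphaCount_binomial_limit (r s d : ℕ) (hr : 2 ≤ r) (hrs : r ≤ s)
    (hd : d = r + s - 1) :
    Tendsto (fun q : ℕ =>
        (1 / (q : ℝ) ^ d) * ∑ n ∈ Finset.range (r * (q - 1) + 1),
          (alphaCount r n q : ℝ) * (Nat.choose (n + s - 1) (s - 1) : ℝ)) atTop
      (nhds (((Nat.factorial r : ℝ) / (Nat.factorial d : ℝ)) * (stirling d r : ℝ))) := by
  obtain ⟨t, rfl⟩ : ∃ t, s = t + 1 := ⟨s - 1, by omega⟩
  have hd' : t + r = d := by omega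
  simp only [← Nat.add_assoc, Nat.add_sub_cancel]
  have hlim := tendsto_finsetSum (range (r+1)) fun j _ =>
    (lim_choose j t d).const_mul ((-1:ℝ)^(r-j) * r.choose j)
  have he : ((Nat.factorial r : ℝ) / (Nat.factorial d : ℝ)) * (stirling d r : ℝ)
      = ∑ j ∈ range (r+1), (-1:ℝ)^(r-j) * r.choose j * ((j:ℝ)^d / d.factorial) := by
    rw [div_mul_eq_mul_div, stirling_formula, sum_div]
    exact sum_congr rfl fun j _ => by ring
  rw [he]
  refine hlim.congr fun q => ?_
  rw [alpha_sum, iter_sum, fwdDiff_iter_eq_sum_shift, mul_sum, hd']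
  refine sum_congr rfl fun j _ => ?_
  simp only [zsmul_eq_mul, smul_eq_mul, zero_add]
  push_cast
  ring
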